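/- arXiv:1604.08709 — 3 statements merged into one kernel-verified Lean document; each statement's English description precedes it below -/
import Mathlib

section
/- Given any pointed FO Kripke model M,s with M = ⟨S, D, {→_i}, V, V_C⟩, define N = ⟨S, {→_i}, {R_i^c}, V⟩ by setting sR_i^c tu iff s→_i t, s→_i u, and V_C(c,t) ≠ V_C(c,u). Then N is an MLKv^r model (each R_i^c satisfies SYM, INCL, ATEUC), and for every ELKv^r formula φ and every state w: M,w ⊨ φ iff N,w ⊩ T(φ). -/
/-- A Kripke frame with binary relations `rel i` and ternary relations `relc i c`,
together with a valuation; an MLKv^r model is such a frame satisfying `IsMLKv`. -/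
structure KFrame where
  S : Type
  rel : ℕ → S → S → Prop
  relc : ℕ → ℕ → S → S → S → Prop
  val : S → ℕ → Prop

/-- The three frame conditions SYM, INCL and ATEUC of MLKv^r models. -/
def KFrame.IsMLKv (M : KFrame) : Prop :=
  (∀ i c s t u, M.relc i c s t u ↔ M.relc i c s u t) ∧
  (∀ i c s t u, M.relc i c s t u → M.rel i s t ∧ M.rel i s u) ∧
  (∀ i c s t u v, M.relc i c s t u → M.rel i s v → M.relc i c s t v ∨ M.relc i c s u v)

/-- The language MLKv^r with unary modalities `box i` (□_i) and `boxc i c` (□_i^c). -/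
inductive FormM : Type
  | top : FormM
  | atom : ℕ → FormM
  | neg : FormM → FormM
  | and : FormM → FormM → FormM
  | box : ℕ → FormM → FormM
  | boxc : ℕ → ℕ → FormM → FormM

namespace FormM
def imp (φ ψ : FormM) : FormM := neg (and φ (neg ψ))
def or (φ ψ : FormM) : FormM := neg (and (neg φ) (neg ψ))
def iff (φ ψ : FormM) : FormM := and (imp φ ψ) (imp ψ φ)
def bot : FormM := neg top
def dia (i : ℕ) (φ : FormM) : FormM := neg (box i (neg φ))
def diac (i c : ℕ) (φ : FormM) : FormM := neg (boxc i c (neg φ))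
end FormM

/-- Satisfaction for MLKv^r formulas; `boxc i c φ` holds at `s` iff every pair of
`relc i c`-successors contains a `φ`-world (i.e. ¬∃ u v with `relc`, both ¬φ). -/
def satM (M : KFrame) : M.S → FormM → Prop
  | _, FormM.top => True
  | s, FormM.atom p => M.val s p
  | s, FormM.neg φ => ¬ satM M s φ
  | s, FormM.and φ ψ => satM M s φ ∧ satM M s ψ
  | s, FormM.box i φ => ∀ t, M.rel i s t → satM M t φ
  | s, FormM.boxc i c φ => ∀ t u, M.relc i c s t u → satM M t φ ∨ satM M u φ

/-- The language ELKv^r with `K i` (knowing that) and `Kv i φ c` (conditionally knowing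
the value of `c` given `φ`). -/
inductive FormE : Type
  | top : FormE
  | atom : ℕ → FormE
  | neg : FormE → FormE
  | and : FormE → FormE → FormE
  | K : ℕ → FormE → FormE
  | Kv : ℕ → FormE → ℕ → FormE

/-- A first-order Kripke model: a Kripke model with a nonempty constant domain `D` and
an assignment `valC` of a value in `D` to each constant at each state. -/
structure FOModel where
  S : Type
  D : Type
  Dnonempty : Nonempty D
  rel : ℕ → S → S → Prop
  val : S → ℕ → Prop
  valC : ℕ → S → D

/-- Satisfaction for ELKv^r formulas over FO Kripke models. -/
def satE (M : FOModel) : M.S → FormE → Prop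
  | _, FormE.top => True
  | s, FormE.atom p => M.val s p
  | s, FormE.neg φ => ¬ satE M s φ
  | s, FormE.and φ ψ => satE M s φ ∧ satE M s ψ
  | s, FormE.K i φ => ∀ t, M.rel i s t → satE M t φ
  | s, FormE.Kv i φ c => ∀ t u, M.rel i s t → M.rel i s u →
      satE M t φ → satE M u φ → M.valC c t = M.valC c u

/-- The translation T from ELKv^r to MLKv^r: it commutes with ⊤, atoms, ¬, ∧,
sends `K i φ` to `□_i T(φ)` and `Kv i φ c` to `□_i^c ¬T(φ)`. -/
def T : FormE → FormM
  | .top => .top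
  | .atom p => .atom p
  | .neg φ => .neg (T φ)
  | .and φ ψ => .and (T φ) (T ψ)
  | .K i φ => .box i (T φ)
  | .Kv i φ c => .boxc i c (.neg (T φ))

/-- The frame obtained from an FO Kripke model by setting
`s R_i^c t u` iff `s →_i t`, `s →_i u` and `V_C(c,t) ≠ V_C(c,u)`. -/
def FOModel.toKFrame (M : FOModel) : KFrame where
  S := M.S
  rel := M.rel
  relc := fun i c s t u => M.rel i s t ∧ M.rel i s u ∧ M.valC c t ≠ M.valC c u
  val := M.val

theorem FOModel.toKFrame_isMLKv (M : FOModel) : M.toKFrame.IsMLKv := by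
  refine ⟨fun i c s t u => ?_, fun i c s t u h => ⟨h.1, h.2.1⟩, fun i c s t u v h hv => ?_⟩
  · exact ⟨fun h => ⟨h.2.1, h.1, h.2.2.symm⟩, fun h => ⟨h.2.1, h.1, h.2.2.symm⟩⟩
  · by_cases htv : M.valC c t = M.valC c v
    · exact Or.inr ⟨h.2.1, hv, fun huv => h.2.2 (htv.trans huv.symm)⟩
    · exact Or.inl ⟨h.1, hv, htv⟩

theorem satE_iff_satM_toKFrame (M : FOModel) (φ : FormE) (w : M.S) :
    satE M w φ ↔ satM M.toKFrame w (T φ) := by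
  induction φ generalizing w with
  | top => exact Iff.rfl
  | atom p => exact Iff.rfl
  | neg φ ih => exact not_congr (ih w)
  | and φ ψ ihφ ihψ => exact and_congr (ihφ w) (ihψ w)
  | K i φ ih => exact forall_congr' fun t => imp_congr_right fun _ => ih t
  | Kv i φ c ih =>
    refine forall₂_congr fun t u => ?_
    change (M.rel i w t → M.rel i w u → satE M t φ → satE M u φ → M.valC c t = M.valC c u) ↔
      (M.rel i w t ∧ M.rel i w u ∧ M.valC c t ≠ M.valC c u →
        ¬ satM M.toKFrame t (T φ) ∨ ¬ satM M.toKFrame u (T φ))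
    rw [← ih t, ← ih u]
    tauto

/-- the frame so obtained is an MLKv^r model, and satisfaction is preserved
under the translation T at every state. -/
theorem stmt1 (M : FOModel) :
    (FOModel.toKFrame M).IsMLKv ∧
    ∀ (φ : FormE) (w : M.S), satE M w φ ↔ satM (FOModel.toKFrame M) w (T φ) :=
  ⟨M.toKFrame_isMLKv, satE_iff_satM_toKFrame M⟩
end

section
/- Existence lemma for ◇_i^c: in the canonical model of SMLKV^r, for any maximal consistent set s, if ◇_i^c ψ ∈ s then there exist maximal consistent sets t, u such that sR_i^c tu and ψ ∈ t and ψ ∈ u. -/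
/-- Uniform substitution of `χ` for the atom `p`. -/
def FormM.subst (p : ℕ) (χ : FormM) : FormM → FormM
  | .top => .top
  | .atom q => if q = p then χ else .atom q
  | .neg φ => .neg (FormM.subst p χ φ)
  | .and φ ψ => .and (FormM.subst p χ φ) (FormM.subst p χ ψ)
  | .box i φ => .box i (FormM.subst p χ φ)
  | .boxc i c φ => .boxc i c (FormM.subst p χ φ)

/-- `ReplM ψ χ φ φ'`: `φ'` is obtained from `φ` by replacing some occurrences of `ψ` by `χ`. -/
inductive ReplM (ψ χ : FormM) : FormM → FormM → Prop
  | base : ReplM ψ χ ψ χ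
  | refl (φ : FormM) : ReplM ψ χ φ φ
  | neg {φ φ'} : ReplM ψ χ φ φ' → ReplM ψ χ (.neg φ) (.neg φ')
  | and {φ₁ φ₁' φ₂ φ₂'} : ReplM ψ χ φ₁ φ₁' → ReplM ψ χ φ₂ φ₂' →
      ReplM ψ χ (.and φ₁ φ₂) (.and φ₁' φ₂')
  | box (i) {φ φ'} : ReplM ψ χ φ φ' → ReplM ψ χ (.box i φ) (.box i φ')
  | boxc (i c) {φ φ'} : ReplM ψ χ φ φ' → ReplM ψ χ (.boxc i c φ) (.boxc i c φ')

/-- `φ` is an instance of a propositional tautology: every Boolean valuation of formulas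
respecting ⊤, ¬ and ∧ makes it true. -/
def TautM (φ : FormM) : Prop :=
  ∀ v : FormM → Bool, v .top = true → (∀ ψ, v (.neg ψ) = !v ψ) →
    (∀ ψ χ, v (.and ψ χ) = (v ψ && v χ)) → v φ = true

/-- The proof system SMLKV^r: TAUT, DISTK, DISTKv^r, Kv^r∨, with rules MP,
necessitation for □_i and □_i^c, uniform substitution, and replacement of equivalents. -/
inductive ProvM : FormM → Prop
  | taut {φ} : TautM φ → ProvM φ
  | distK (i : ℕ) (φ ψ : FormM) :
      ProvM (.imp (.box i (.imp φ ψ)) (.imp (.box i φ) (.box i ψ)))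
  | distKv (i c : ℕ) (φ ψ : FormM) :
      ProvM (.imp (.box i (.imp φ ψ)) (.imp (.boxc i c φ) (.boxc i c ψ)))
  | kvOr (i c : ℕ) (φ ψ : FormM) :
      ProvM (.imp (.and (.dia i (.and φ ψ)) (.diac i c (.or φ ψ)))
        (.or (.diac i c φ) (.diac i c ψ)))
  | mp {φ ψ} : ProvM (.imp φ ψ) → ProvM φ → ProvM ψ
  | necK (i : ℕ) {φ} : ProvM φ → ProvM (.box i φ)
  | necKv (i c : ℕ) {φ} : ProvM φ → ProvM (.boxc i c φ)
  | subst (p : ℕ) (χ : FormM) {φ} : ProvM φ → ProvM (FormM.subst p χ φ)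
  | re {ψ χ φ φ'} : ProvM (.iff ψ χ) → ReplM ψ χ φ φ' → ProvM (.iff φ φ')

/-- Conjunction of a finite list of formulas. -/
def conjM (L : List FormM) : FormM := L.foldr FormM.and FormM.top

/-- `φ` is derivable from `Γ` in SMLKV^r. -/
def ProvFromM (Γ : Set FormM) (φ : FormM) : Prop :=
  ∃ L : List FormM, (∀ ψ ∈ L, ψ ∈ Γ) ∧ ProvM (.imp (conjM L) φ)

/-- `Γ` is SMLKV^r-consistent. -/
def ConsistentM (Γ : Set FormM) : Prop := ¬ ProvFromM Γ .bot

/-- `s` is a maximal SMLKV^r-consistent set. -/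
def MCSM (s : Set FormM) : Prop :=
  ConsistentM s ∧ ∀ φ ∉ s, ¬ ConsistentM (insert φ s)

/-- Canonical binary relation: `s →_i t` iff `{φ : □_i φ ∈ s} ⊆ t`. -/
def canRel (i : ℕ) (s t : Set FormM) : Prop := ∀ φ, FormM.box i φ ∈ s → φ ∈ t

/-- Canonical ternary relation: `s R_i^c t u` iff `{φ : □_i φ ∈ s} ⊆ t ∩ u` and
`{ψ : □_i^c ψ ∈ s} ⊆ t ∪ u`. -/
def canRelc (i c : ℕ) (s t u : Set FormM) : Prop :=
  (∀ φ, FormM.box i φ ∈ s → φ ∈ t ∧ φ ∈ u) ∧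
  (∀ ψ, FormM.boxc i c ψ ∈ s → ψ ∈ t ∨ ψ ∈ u)

theorem TautM.provM_mp {φ ψ : FormM} (h : TautM (.imp φ ψ)) (hφ : ProvM φ) : ProvM ψ :=
  .mp (.taut h) hφ

theorem TautM.provM_mp₂ {φ ψ χ : FormM} (h : TautM (.imp φ (.imp ψ χ))) (hφ : ProvM φ)
    (hψ : ProvM ψ) : ProvM χ :=
  .mp (h.provM_mp hφ) hψ

theorem eval_conjM {v : FormM → Bool} (hT : v .top = true)
    (hA : ∀ ψ χ, v (.and ψ χ) = (v ψ && v χ)) (L : List FormM) :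
    v (conjM L) = true ↔ ∀ φ ∈ L, v φ = true := by
  induction L with
  | nil => simpa [conjM] using hT
  | cons a L ih =>
    have : conjM (a :: L) = .and a (conjM L) := rfl
    simp [this, hA, ih]

/-- The deduction theorem for derivability from a set. -/
theorem ProvFromM.imp_of_insert {Γ : Set FormM} {φ χ : FormM}
    (h : ProvFromM (insert φ Γ) χ) : ProvFromM Γ (.imp φ χ) := by
  classical
  obtain ⟨L, hL, hp⟩ := h
  refine ⟨L.filter (· ≠ φ), fun ψ hψ => ?_, TautM.provM_mp ?_ hp⟩
  · simp only [List.mem_filter, decide_eq_true_eq] at hψ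
    exact (hL ψ hψ.1).resolve_left hψ.2
  · intro v hT hN hA
    have h₁ := eval_conjM hT hA L
    have h₂ := eval_conjM hT hA (L.filter (· ≠ φ))
    simp only [List.mem_filter, decide_eq_true_eq] at h₂
    simp only [FormM.imp, hN, hA]
    have key : v (conjM (L.filter (· ≠ φ))) = true → v φ = true → v (conjM L) = true := by
      intro hc hφ
      refine h₁.2 fun ψ hψ => ?_
      by_cases he : ψ = φ
      · rwa [he]
      · exact h₂.1 hc ψ ⟨hψ, he⟩
    revert key
    cases v (conjM (L.filter (· ≠ φ))) <;> cases v φ <;> cases v (conjM L) <;> simp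

theorem ProvFromM.mp {Γ : Set FormM} {φ χ : FormM} (h : ProvFromM Γ (.imp φ χ))
    (hφ : ProvFromM Γ φ) : ProvFromM Γ χ := by
  obtain ⟨L₁, hL₁, hp₁⟩ := h
  obtain ⟨L₂, hL₂, hp₂⟩ := hφ
  refine ⟨L₁ ++ L₂, fun ψ hψ => ?_, TautM.provM_mp₂ ?_ hp₁ hp₂⟩
  · exact (List.mem_append.1 hψ).elim (hL₁ ψ) (hL₂ ψ)
  · intro v hT hN hA
    have h₁ := eval_conjM hT hA L₁
    have h₂ := eval_conjM hT hA L₂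
    have h₃ := eval_conjM hT hA (L₁ ++ L₂)
    have key : v (conjM (L₁ ++ L₂)) = true → v (conjM L₁) = true ∧ v (conjM L₂) = true := by
      rw [h₁, h₂, h₃]
      exact fun h => ⟨fun ψ hψ => h ψ (List.mem_append_left _ hψ),
        fun ψ hψ => h ψ (List.mem_append_right _ hψ)⟩
    simp only [FormM.imp, hN, hA]
    revert key
    cases v (conjM (L₁ ++ L₂)) <;> cases v (conjM L₁) <;> cases v (conjM L₂) <;>
      cases v φ <;> cases v χ <;> simp

theorem ProvM.provFromM {Γ : Set FormM} {φ : FormM} (h : ProvM φ) : ProvFromM Γ φ := by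
  refine ⟨[], by simp, TautM.provM_mp ?_ h⟩
  intro v hT hN hA
  simp only [FormM.imp, hN, hA]
  cases v φ <;> simp

theorem ProvFromM.of_mem {Γ : Set FormM} {φ : FormM} (h : φ ∈ Γ) : ProvFromM Γ φ := by
  refine ⟨[φ], by simpa using h, .taut ?_⟩
  intro v hT hN hA
  simp only [conjM, List.foldr, FormM.imp, hN, hA]
  cases v φ <;> simp

/-- Lindenbaum's lemma. -/
theorem ConsistentM.exists_MCSM {Γ : Set FormM} (h : ConsistentM Γ) :
    ∃ t, Γ ⊆ t ∧ MCSM t := by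
  obtain ⟨t, hΓ, ht⟩ := zorn_subset_nonempty {Δ | ConsistentM Δ} (fun C hC hch hne => by
    refine ⟨⋃₀ C, ?_, fun _ => Set.subset_sUnion_of_mem⟩
    rintro ⟨L, hL, hp⟩
    obtain ⟨Δ, hΔ, hLΔ⟩ := hch.directedOn.exists_mem_subset_of_finset_subset_biUnion
      (f := id) hne (s := (L.finite_toSet).toFinset) (by
        intro φ hφ
        simpa using hL φ (by simpa using hφ))
    exact hC hΔ ⟨L, fun ψ hψ => hLΔ (by simpa using hψ), hp⟩) Γ h
  refine ⟨t, hΓ, ht.prop, fun φ hφ hc => hφ ?_⟩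
  exact ht.le_of_ge hc (Set.subset_insert φ t) (Set.mem_insert φ t)

namespace MCSM

variable {s : Set FormM} {φ ψ χ : FormM}

theorem mem_of_provFromM (hs : MCSM s) (h : ProvFromM s φ) : φ ∈ s := by
  by_contra hφ
  exact hs.1 ((not_not.1 (hs.2 φ hφ)).imp_of_insert.mp h)

theorem mem_of_provM (hs : MCSM s) (h : ProvM φ) : φ ∈ s :=
  hs.mem_of_provFromM h.provFromM

theorem mem_mp (hs : MCSM s) (h : FormM.imp φ ψ ∈ s) (hφ : φ ∈ s) : ψ ∈ s :=
  hs.mem_of_provFromM ((ProvFromM.of_mem h).mp (.of_mem hφ))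

theorem mem_of_provM_imp (hs : MCSM s) (h : ProvM (.imp φ ψ)) (hφ : φ ∈ s) : ψ ∈ s :=
  hs.mem_mp (hs.mem_of_provM h) hφ

theorem and_mem_iff (hs : MCSM s) : FormM.and φ ψ ∈ s ↔ φ ∈ s ∧ ψ ∈ s := by
  refine ⟨fun h => ⟨hs.mem_of_provM_imp (.taut ?_) h, hs.mem_of_provM_imp (.taut ?_) h⟩,
    fun h => hs.mem_mp (hs.mem_of_provM_imp (.taut ?_) h.1) h.2⟩ <;>
  · intro v hT hN hA
    simp only [FormM.imp, hN, hA]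
    cases v φ <;> cases v ψ <;> simp

theorem neg_mem_iff (hs : MCSM s) : FormM.neg φ ∈ s ↔ φ ∉ s := by
  constructor
  · intro h hφ
    refine hs.1 (.of_mem (hs.mem_mp (hs.mem_of_provM_imp (.taut ?_) h) hφ))
    intro v hT hN hA
    simp only [FormM.imp, FormM.bot, hN, hA]
    cases v φ <;> simp
  · intro hφ
    refine hs.mem_of_provFromM (.mp (ProvM.taut ?_).provFromM
      (not_not.1 (hs.2 φ hφ)).imp_of_insert)
    intro v hT hN hA
    simp only [FormM.imp, FormM.bot, hN, hA, hT]
    cases v φ <;> simp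

theorem or_mem_iff (hs : MCSM s) : FormM.or φ ψ ∈ s ↔ φ ∈ s ∨ ψ ∈ s := by
  rw [FormM.or, hs.neg_mem_iff, hs.and_mem_iff, hs.neg_mem_iff, hs.neg_mem_iff]
  tauto

theorem box_mono (hs : MCSM s) (i : ℕ) (h : ProvM (.imp φ ψ)) (hφ : FormM.box i φ ∈ s) :
    FormM.box i ψ ∈ s :=
  hs.mem_of_provM_imp (.mp (.distK i φ ψ) (.necK i h)) hφ

theorem boxc_mp (hs : MCSM s) {i c : ℕ} (h : FormM.box i (.imp φ ψ) ∈ s)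
    (hφ : FormM.boxc i c φ ∈ s) : FormM.boxc i c ψ ∈ s :=
  hs.mem_mp (hs.mem_of_provM_imp (.distKv i c φ ψ) h) hφ

theorem boxc_mono (hs : MCSM s) {i c : ℕ} (h : ProvM (.imp φ ψ))
    (hφ : FormM.boxc i c φ ∈ s) : FormM.boxc i c ψ ∈ s :=
  hs.boxc_mp (hs.mem_of_provM (.necK i h)) hφ

theorem box_and (hs : MCSM s) {i : ℕ} (hφ : FormM.box i φ ∈ s) (hψ : FormM.box i ψ ∈ s) :
    FormM.box i (.and φ ψ) ∈ s := by
  refine hs.mem_mp (hs.mem_of_provM_imp (.distK i ψ _) (hs.box_mono i (.taut ?_) hφ)) hψ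
  intro v hT hN hA
  simp only [FormM.imp, hN, hA]
  cases v φ <;> cases v ψ <;> simp

/-- The axiom `Kv^r∨` in terms of `□_i^c`. -/
theorem boxc_and (hs : MCSM s) {i c : ℕ} (hφ : FormM.boxc i c φ ∈ s)
    (hψ : FormM.boxc i c ψ ∈ s) (h : FormM.box i (.or φ ψ) ∉ s) :
    FormM.boxc i c (.and φ ψ) ∈ s := by
  by_contra hn
  have hdia : FormM.dia i (.and (.neg φ) (.neg ψ)) ∈ s := hs.neg_mem_iff.2 h
  have hdiac : FormM.diac i c (.or (.neg φ) (.neg ψ)) ∈ s := by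
    refine hs.neg_mem_iff.2 fun hm => hn (hs.boxc_mono (.taut ?_) hm)
    intro v hT hN hA
    simp only [FormM.imp, FormM.or, hN, hA]
    cases v φ <;> cases v ψ <;> simp
  have neg_neg {χ : FormM} (hχ : FormM.boxc i c χ ∈ s) : FormM.diac i c (.neg χ) ∉ s := by
    refine fun hm => hs.neg_mem_iff.1 hm (hs.boxc_mono (.taut ?_) hχ)
    intro v hT hN hA
    simp only [FormM.imp, hN, hA]
    cases v χ <;> simp
  exact (hs.or_mem_iff.1 (hs.mem_of_provM_imp (.kvOr i c (.neg φ) (.neg ψ))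
    (hs.and_mem_iff.2 ⟨hdia, hdiac⟩))).elim (neg_neg hφ) (neg_neg hψ)

/-- If `◇_i^c ψ ∈ s`, then `ψ` is consistent with `{φ : □_i φ ∈ s}` together with any
conjunction-closed subset of `{φ : □_i^c φ ∈ s}`. -/
theorem consistentM_insert_of_diac_mem (hs : MCSM s) {i c : ℕ} (h : FormM.diac i c ψ ∈ s)
    {M : Set FormM} (hM : ∀ a ∈ M, FormM.boxc i c a ∈ s) (htop : FormM.top ∈ M)
    (hand : ∀ a ∈ M, ∀ b ∈ M, FormM.and a b ∈ M) :
    ConsistentM (insert ψ ({φ | FormM.box i φ ∈ s} ∪ M)) := by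
  intro hinc
  obtain ⟨L, hL, hp⟩ := hinc.imp_of_insert
  have key : ∀ L : List FormM, (∀ φ ∈ L, φ ∈ {φ | FormM.box i φ ∈ s} ∪ M) →
      ∃ a ∈ M, FormM.box i (.imp a (conjM L)) ∈ s := by
    intro L
    induction L with
    | nil =>
      refine fun _ => ⟨.top, htop, hs.mem_of_provM (.necK i (.taut ?_))⟩
      intro v hT hN hA
      simp [conjM, FormM.imp, hN, hA, hT]
    | cons d L ih =>
      intro hL
      obtain ⟨a, ha, hb⟩ := ih fun φ hφ => hL φ (List.mem_cons_of_mem _ hφ)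
      have hcons : conjM (d :: L) = .and d (conjM L) := rfl
      rcases hL d List.mem_cons_self with hd | hd
      · refine ⟨a, ha, hs.box_mono i (.taut ?_) (hs.box_and hd hb)⟩
        intro v hT hN hA
        simp only [FormM.imp, hcons, hN, hA]
        cases v a <;> cases v d <;> cases v (conjM L) <;> simp
      · refine ⟨.and d a, hand d hd a ha, hs.box_mono i (.taut ?_) hb⟩
        intro v hT hN hA
        simp only [FormM.imp, hcons, hN, hA]
        cases v a <;> cases v d <;> cases v (conjM L) <;> simp
  obtain ⟨a, ha, hb⟩ := key L hL
  refine hs.neg_mem_iff.1 h (hs.boxc_mono (.mp (.taut ?_) hp) (hs.boxc_mp hb (hM a ha)))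
  intro v hT hN hA
  simp only [FormM.imp, FormM.bot, hN, hA, hT]
  cases v (conjM L) <;> cases v ψ <;> simp

end MCSM


/-- existence lemma for ◇_i^c in the canonical model of SMLKV^r. -/
theorem stmt6 (i c : ℕ) (ψ : FormM) (s : Set FormM) (hs : MCSM s)
    (h : FormM.diac i c ψ ∈ s) :
    ∃ t u : Set FormM, MCSM t ∧ MCSM u ∧ canRelc i c s t u ∧ ψ ∈ t ∧ ψ ∈ u := by
  have hnec {a : FormM} (ha : ProvM a) : FormM.boxc i c a ∈ s := hs.mem_of_provM (.necKv i c ha)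
  have htop : ProvM .top := .taut fun _ hT _ _ => hT
  have intro_and (a b : FormM) : ProvM (.imp a (.imp b (.and a b))) := by
    refine .taut fun v hT hN hA => ?_
    simp only [FormM.imp, hN, hA]
    cases v a <;> cases v b <;> simp
  have intro_and' (a b : FormM) : ProvM (.imp b (.imp a (.and a b))) := by
    refine .taut fun v hT hN hA => ?_
    simp only [FormM.imp, hN, hA]
    cases v a <;> cases v b <;> simp
  obtain ⟨t, hst, ht⟩ := (hs.consistentM_insert_of_diac_mem h (M := {a | ProvM a})
    (fun _ => hnec) htop fun a ha b hb => .mp (.mp (intro_and a b) ha) hb).exists_MCSM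
  have hbox : ∀ φ, FormM.box i φ ∈ s → φ ∈ t := fun φ hφ => hst (.inr (.inl hφ))
  obtain ⟨u, hsu, hu⟩ := (hs.consistentM_insert_of_diac_mem h
    (M := {a | FormM.boxc i c a ∈ s ∧ (a ∉ t ∨ ProvM a)}) (fun _ ha => ha.1)
    ⟨hnec htop, .inr htop⟩ (by
      rintro a ⟨ha, ha'⟩ b ⟨hb, hb'⟩
      rcases ha' with hat | hpa
      · refine ⟨?_, .inl fun hab => hat (ht.and_mem_iff.1 hab).1⟩
        rcases hb' with hbt | hpb
        · exact hs.boxc_and ha hb fun hor => (ht.or_mem_iff.1 (hbox _ hor)).elim hat hbt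
        · exact hs.boxc_mono (.mp (intro_and' a b) hpb) ha
      · refine ⟨hs.boxc_mono (.mp (intro_and a b) hpa) hb, ?_⟩
        exact hb'.imp (fun hbt hab => hbt (ht.and_mem_iff.1 hab).2)
          fun hpb => .mp (.mp (intro_and a b) hpa) hpb)).exists_MCSM
  refine ⟨t, u, ht, hu, ⟨fun φ hφ => ⟨hbox φ hφ, hsu (.inr (.inl hφ))⟩, fun φ hφ => ?_⟩,
    hst (.inl rfl), hsu (.inl rfl)⟩
  by_contra! hn
  exact hn.2 (hsu (.inr (.inr ⟨hφ, .inl hn.1⟩)))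
end

section
/- Hennessy–Milner theorem for LKv^b: if M and N are finite MLKv^r models, then M,s and N,t are C-bisimilar if and only if they satisfy exactly the same LKv^b formulas. Consequently (since LKv^b and the unary fragment LKv^r are equally expressive), for finite MLKv^r models, C-bisimilarity of M,s and N,t is also equivalent to M,s and N,t satisfying exactly the same LKv^r formulas. -/
/-- The language LKv^b with the binary modality `boxc i c φ ψ` (□_i^c(φ,ψ)). -/
inductive FormB : Type
  | top : FormB
  | atom : ℕ → FormB
  | neg : FormB → FormB
  | and : FormB → FormB → FormB
  | box : ℕ → FormB → FormB
  | boxc : ℕ → ℕ → FormB → FormB → FormB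

namespace FormB
def imp (φ ψ : FormB) : FormB := neg (and φ (neg ψ))
def or (φ ψ : FormB) : FormB := neg (and (neg φ) (neg ψ))
def iff (φ ψ : FormB) : FormB := and (imp φ ψ) (imp ψ φ)
def bot : FormB := neg top
def dia (i : ℕ) (φ : FormB) : FormB := neg (box i (neg φ))
/-- ◇_i^c(φ,ψ) abbreviates ¬□_i^c(¬φ,¬ψ). -/
def diac (i c : ℕ) (φ ψ : FormB) : FormB := neg (boxc i c (neg φ) (neg ψ))
end FormB

/-- Satisfaction for LKv^b formulas over frames with ternary relations;
`s ⊩ ◇_i^c(φ,ψ)` iff there are `t,u` with `relc i c s t u`, `t ⊩ φ` and `u ⊩ ψ`. -/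
def satB (M : KFrame) : M.S → FormB → Prop
  | _, FormB.top => True
  | s, FormB.atom p => M.val s p
  | s, FormB.neg φ => ¬ satB M s φ
  | s, FormB.and φ ψ => satB M s φ ∧ satB M s ψ
  | s, FormB.box i φ => ∀ t, M.rel i s t → satB M t φ
  | s, FormB.boxc i c φ ψ => ∀ t u, M.relc i c s t u → satB M t φ ∨ satB M u ψ

/-- `Z` is a C-bisimulation between the models `M` and `N`: Inv, Zig, Zag for the binary
relations and Kvb-Zig, Kvb-Zag for the ternary relations. -/
def CBisim (M N : KFrame) (Z : M.S → N.S → Prop) : Prop :=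
  ∀ s₁ s₂, Z s₁ s₂ →
    (∀ p, M.val s₁ p ↔ N.val s₂ p) ∧
    (∀ i t₁, M.rel i s₁ t₁ → ∃ t₂, N.rel i s₂ t₂ ∧ Z t₁ t₂) ∧
    (∀ i t₂, N.rel i s₂ t₂ → ∃ t₁, M.rel i s₁ t₁ ∧ Z t₁ t₂) ∧
    (∀ i c t₁ u₁, M.relc i c s₁ t₁ u₁ →
      ∃ t₂ u₂, N.relc i c s₂ t₂ u₂ ∧ Z t₁ t₂ ∧ Z u₁ u₂) ∧
    (∀ i c t₂ u₂, N.relc i c s₂ t₂ u₂ →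
      ∃ t₁ u₁, M.relc i c s₁ t₁ u₁ ∧ Z t₁ t₂ ∧ Z u₁ u₂)

/-- Pointed models are C-bisimilar iff some C-bisimulation links the points. -/
def CBisimilar (M N : KFrame) (s : M.S) (t : N.S) : Prop :=
  ∃ Z, CBisim M N Z ∧ Z s t

/-- `φ` belongs to the unary fragment MLKv^r of LKv^b: the two arguments of every
`boxc` coincide. -/
def FormB.IsUnary : FormB → Prop
  | .top => True
  | .atom _ => True
  | .neg φ => FormB.IsUnary φ
  | .and φ ψ => FormB.IsUnary φ ∧ FormB.IsUnary ψ
  | .box _ φ => FormB.IsUnary φ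
  | .boxc _ _ φ ψ => φ = ψ ∧ FormB.IsUnary φ

/-- C-bisimilar states satisfy the same LKv^b formulas. -/
theorem CBisim.satB_iff {M N : KFrame} {Z : M.S → N.S → Prop} (hZ : CBisim M N Z) (φ : FormB) :
    ∀ s t, Z s t → (satB M s φ ↔ satB N t φ) := by
  induction φ with
  | top => intro s t _; rfl
  | atom p => intro s t h; exact (hZ s t h).1 p
  | neg φ ih => intro s t h; exact not_congr (ih s t h)
  | and φ ψ ihφ ihψ => intro s t h; exact and_congr (ihφ s t h) (ihψ s t h)
  | box i φ ih =>
    intro s t h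
    obtain ⟨-, zig, zag, -, -⟩ := hZ s t h
    constructor
    · intro hs t₂ ht₂
      obtain ⟨t₁, ht₁, hz⟩ := zag i t₂ ht₂
      exact (ih _ _ hz).1 (hs t₁ ht₁)
    · intro ht t₁ ht₁
      obtain ⟨t₂, ht₂, hz⟩ := zig i t₁ ht₁
      exact (ih _ _ hz).2 (ht t₂ ht₂)
  | boxc i c φ ψ ihφ ihψ =>
    intro s t h
    obtain ⟨-, -, -, zig, zag⟩ := hZ s t h
    constructor
    · intro hs t₂ u₂ htu
      obtain ⟨t₁, u₁, htu₁, hzt, hzu⟩ := zag i c t₂ u₂ htu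
      exact (hs t₁ u₁ htu₁).imp (ihφ _ _ hzt).1 (ihψ _ _ hzu).1
    · intro ht t₁ u₁ htu
      obtain ⟨t₂, u₂, htu₂, hzt, hzu⟩ := zig i c t₁ u₁ htu
      exact (ht t₂ u₂ htu₂).imp (ihφ _ _ hzt).2 (ihψ _ _ hzu).2

theorem satB_or {M : KFrame} {s : M.S} {φ ψ : FormB} :
    satB M s (φ.or ψ) ↔ satB M s φ ∨ satB M s ψ := by
  simp only [FormB.or, satB]
  tauto

theorem satB_dia {M : KFrame} {s : M.S} {i : ℕ} {φ : FormB} :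
    satB M s (φ.dia i) ↔ ∃ t, M.rel i s t ∧ satB M t φ := by
  simp [FormB.dia, satB]

theorem satB_diac {M : KFrame} {s : M.S} {i c : ℕ} {φ ψ : FormB} :
    satB M s (FormB.diac i c φ ψ) ↔
      ∃ t u, M.relc i c s t u ∧ satB M t φ ∧ satB M u ψ := by
  simp [FormB.diac, satB]

namespace FormB

/-- An LKv^r formula equivalent to `diac i c φ ψ` over MLKv^r models. -/
def unaryDiac (i c : ℕ) (φ ψ : FormB) : FormB :=
  and (and (dia i φ) (dia i ψ)) (diac i c (or φ ψ) (or φ ψ))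

theorem IsUnary.unaryDiac {φ ψ : FormB} (hφ : φ.IsUnary) (hψ : ψ.IsUnary) (i c : ℕ) :
    (unaryDiac i c φ ψ).IsUnary := by
  simp [FormB.unaryDiac, dia, diac, FormB.or, IsUnary, hφ, hψ]

end FormB

theorem KFrame.IsMLKv.satB_unaryDiac {M : KFrame} (hM : M.IsMLKv) {s : M.S} {i c : ℕ}
    {φ ψ : FormB} :
    satB M s (FormB.unaryDiac i c φ ψ) ↔ satB M s (FormB.diac i c φ ψ) := by
  obtain ⟨sym, incl, ateuc⟩ := hM
  change (satB M s (φ.dia i) ∧ satB M s (ψ.dia i)) ∧ satB M s (.diac i c _ _) ↔ _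
  simp only [satB_dia, satB_diac, satB_or]
  constructor
  · rintro ⟨⟨⟨v, hv, hvφ⟩, w, hw, hwψ⟩, t, u, htu, ht | ht, hu | hu⟩
    · rcases ateuc _ _ _ _ _ _ htu hw with h | h
      exacts [⟨t, w, h, ht, hwψ⟩, ⟨u, w, h, hu, hwψ⟩]
    · exact ⟨t, u, htu, ht, hu⟩
    · exact ⟨u, t, (sym _ _ _ _ _).1 htu, hu, ht⟩
    · rcases ateuc _ _ _ _ _ _ htu hv with h | h
      exacts [⟨v, t, (sym _ _ _ _ _).1 h, hvφ, ht⟩, ⟨v, u, (sym _ _ _ _ _).1 h, hvφ, hu⟩]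
  · rintro ⟨t, u, htu, ht, hu⟩
    obtain ⟨hst, hsu⟩ := incl _ _ _ _ _ htu
    exact ⟨⟨⟨t, hst, ht⟩, u, hsu, hu⟩, t, u, htu, .inl ht, .inr hu⟩

/-- Two pointed models satisfy the same LKv^r formulas. -/
def UnaryEquiv (M N : KFrame) (s : M.S) (t : N.S) : Prop :=
  ∀ φ : FormB, φ.IsUnary → (satB M s φ ↔ satB N t φ)

theorem UnaryEquiv.symm {M N : KFrame} {s : M.S} {t : N.S} (h : UnaryEquiv M N s t) :
    UnaryEquiv N M t s :=
  fun φ hφ => (h φ hφ).symm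

theorem exists_isUnary_of_not_unaryEquiv {M N : KFrame} {s : M.S} {t : N.S}
    (h : ¬ UnaryEquiv M N s t) : ∃ φ : FormB, φ.IsUnary ∧ satB M s φ ∧ ¬ satB N t φ := by
  simp only [UnaryEquiv, not_forall] at h
  obtain ⟨φ, hφ, hne⟩ := h
  by_cases hs : satB M s φ
  · exact ⟨φ, hφ, hs, fun ht => hne (iff_of_true hs ht)⟩
  · exact ⟨φ.neg, hφ, hs, fun ht => hne (iff_of_false hs ht)⟩

/-- Relative to a finite model `N`, the LKv^r theory of a state is given by one formula. -/
theorem exists_isUnary_characteristic (M N : KFrame) [Finite N.S] (s : M.S) :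
    ∃ χ : FormB, χ.IsUnary ∧ satB M s χ ∧ ∀ t, satB N t χ → UnaryEquiv M N s t := by
  classical
  have := Fintype.ofFinite N.S
  suffices h : ∀ A : Finset N.S, ∃ χ : FormB, χ.IsUnary ∧ satB M s χ ∧
      ∀ t ∈ A, satB N t χ → UnaryEquiv M N s t by
    simpa using h Finset.univ
  intro A
  induction A using Finset.induction_on with
  | empty => exact ⟨.top, trivial, trivial, by simp⟩
  | insert a A _ ih =>
    obtain ⟨χ, hχ, hs, hA⟩ := ih
    by_cases ha : UnaryEquiv M N s a
    · refine ⟨χ, hχ, hs, fun t ht h => ?_⟩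
      rcases Finset.mem_insert.1 ht with rfl | ht
      exacts [ha, hA t ht h]
    · obtain ⟨φ, hφ, hsφ, haφ⟩ := exists_isUnary_of_not_unaryEquiv ha
      refine ⟨.and φ χ, ⟨hφ, hχ⟩, ⟨hsφ, hs⟩, fun t ht h => ?_⟩
      rcases Finset.mem_insert.1 ht with rfl | ht
      exacts [absurd h.1 haφ, hA t ht h.2]

theorem UnaryEquiv.zig {M N : KFrame} [Finite N.S] {s : M.S} {t : N.S}
    (h : UnaryEquiv M N s t) {i : ℕ} {s' : M.S} (hs : M.rel i s s') :
    ∃ t', N.rel i t t' ∧ UnaryEquiv M N s' t' := by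
  obtain ⟨χ, hχ, hsχ, H⟩ := exists_isUnary_characteristic M N s'
  obtain ⟨t', ht, ht'⟩ := satB_dia.1 ((h (χ.dia i) hχ).1 (satB_dia.2 ⟨s', hs, hsχ⟩))
  exact ⟨t', ht, H t' ht'⟩

theorem UnaryEquiv.kvb_zig {M N : KFrame} [Finite N.S] (hM : M.IsMLKv) (hN : N.IsMLKv)
    {s : M.S} {t : N.S} (h : UnaryEquiv M N s t) {i c : ℕ} {s₁ s₂ : M.S}
    (hs : M.relc i c s s₁ s₂) :
    ∃ t₁ t₂, N.relc i c t t₁ t₂ ∧ UnaryEquiv M N s₁ t₁ ∧ UnaryEquiv M N s₂ t₂ := by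
  obtain ⟨χ₁, hχ₁, hs₁, H₁⟩ := exists_isUnary_characteristic M N s₁
  obtain ⟨χ₂, hχ₂, hs₂, H₂⟩ := exists_isUnary_characteristic M N s₂
  have hsat := hM.satB_unaryDiac.2 (satB_diac.2 ⟨s₁, s₂, hs, hs₁, hs₂⟩)
  obtain ⟨t₁, t₂, ht, ht₁, ht₂⟩ :=
    satB_diac.1 (hN.satB_unaryDiac.1 ((h _ (hχ₁.unaryDiac hχ₂ i c)).1 hsat))
  exact ⟨t₁, t₂, ht, H₁ t₁ ht₁, H₂ t₂ ht₂⟩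

/-- On finite MLKv^r models, LKv^r-equivalence is a C-bisimulation. -/
theorem cBisim_unaryEquiv {M N : KFrame} [Finite M.S] [Finite N.S] (hM : M.IsMLKv)
    (hN : N.IsMLKv) : CBisim M N (UnaryEquiv M N) := by
  intro s t h
  refine ⟨fun p => h (.atom p) trivial, fun i s' hs => h.zig hs, fun i t' ht => ?_,
    fun i c s₁ s₂ hs => h.kvb_zig hM hN hs, fun i c t₁ t₂ ht => ?_⟩
  · obtain ⟨s', hs, hst⟩ := h.symm.zig ht
    exact ⟨s', hs, hst.symm⟩
  · obtain ⟨s₁, s₂, hs, h₁, h₂⟩ := h.symm.kvb_zig hN hM ht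
    exact ⟨s₁, s₂, hs, h₁.symm, h₂.symm⟩

/-- Hennessy–Milner theorem: for finite MLKv^r models, C-bisimilarity
coincides with LKv^b-equivalence, and consequently also with equivalence in the unary
fragment LKv^r. -/
theorem stmt17 (M N : KFrame) (hM : M.IsMLKv) (hN : N.IsMLKv)
    (hMfin : Finite M.S) (hNfin : Finite N.S) (s : M.S) (t : N.S) :
    (CBisimilar M N s t ↔ ∀ φ : FormB, (satB M s φ ↔ satB N t φ)) ∧
    (CBisimilar M N s t ↔ ∀ φ : FormB, FormB.IsUnary φ → (satB M s φ ↔ satB N t φ)) := by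
  have hsat : CBisimilar M N s t → ∀ φ : FormB, (satB M s φ ↔ satB N t φ) := by
    rintro ⟨Z, hZ, hst⟩ φ
    exact hZ.satB_iff φ s t hst
  have hbisim : UnaryEquiv M N s t → CBisimilar M N s t :=
    fun h => ⟨UnaryEquiv M N, cBisim_unaryEquiv hM hN, h⟩
  exact ⟨⟨hsat, fun h => hbisim fun φ _ => h φ⟩, ⟨fun h φ _ => hsat h φ, hbisim⟩⟩
end
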